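/- For every t ≥ 2 and every k ≥ 4t - 3, there exists an isolation set of size k in A_{k,t}. -/

import Mathlib

/-- An isolation set of size `n` in `A_{k,t}`: sequences `x` and `y` of
`t`-element subsets of `{1,…,k}` with `x i ∩ y i ≠ ∅` for all `i`, and for
`i ≠ j`, `x i ∩ y j = ∅` or `x j ∩ y i = ∅`. -/
def IsIsolationSet (k t n : ℕ) (x y : Fin n → Finset ℕ) : Prop :=
  (∀ i, x i ⊆ Finset.Icc 1 k ∧ (x i).card = t) ∧
  (∀ i, y i ⊆ Finset.Icc 1 k ∧ (y i).card = t) ∧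
  (∀ i, (x i ∩ y i).Nonempty) ∧
  (∀ i j, i ≠ j → x i ∩ y j = ∅ ∨ x j ∩ y i = ∅)

/-- The cyclic translate by `c` of `{0, …, t - 1}` modulo `k`, as a subset of `{1, …, k}`. -/
def cyclicInterval (k t c : ℕ) : Finset ℕ :=
  (Finset.range t).image fun a => (c + a) % k + 1

theorem cyclicInterval_subset {k : ℕ} (hk : 0 < k) (t c : ℕ) :
    cyclicInterval k t c ⊆ Finset.Icc 1 k := by
  intro z hz
  obtain ⟨a, -, rfl⟩ := Finset.mem_image.1 hz
  exact Finset.mem_Icc.2 ⟨Nat.succ_pos _, Nat.mod_lt _ hk⟩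

theorem card_cyclicInterval {k t : ℕ} (htk : t ≤ k) (c : ℕ) :
    (cyclicInterval k t c).card = t := by
  rw [cyclicInterval, Finset.card_image_of_injOn, Finset.card_range]
  intro a ha b hb h
  have h' : c + a ≡ c + b [MOD k] := Nat.succ_injective h
  exact (Nat.ModEq.add_left_cancel' c h').eq_of_lt_of_lt
    ((Finset.mem_range.1 (by simpa using ha)).trans_le htk)
    ((Finset.mem_range.1 (by simpa using hb)).trans_le htk)

/-- If the intervals of length `t` starting at `c + (t - 1)` and at `d` meet, then
`d` follows `c` cyclically at distance at most `2 * t - 2`. -/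
theorem exists_add_modEq_of_cyclicInterval_inter_ne_empty {k t c d : ℕ}
    (h : cyclicInterval k t (c + (t - 1)) ∩ cyclicInterval k t d ≠ ∅) :
    ∃ s ≤ 2 * t - 2, c + s ≡ d [MOD k] := by
  obtain ⟨z, hz⟩ := Finset.nonempty_iff_ne_empty.2 h
  obtain ⟨hz₁, hz₂⟩ := Finset.mem_inter.1 hz
  obtain ⟨a, ha, rfl⟩ := Finset.mem_image.1 hz₁
  obtain ⟨b, hb, hab⟩ := Finset.mem_image.1 hz₂
  rw [Finset.mem_range] at ha hb
  have h' : d + b ≡ c + (t - 1) + a [MOD k] := Nat.succ_injective hab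
  refine ⟨t - 1 + a - b, by omega, Nat.ModEq.add_right_cancel' b ?_⟩
  rw [show c + (t - 1 + a - b) + b = c + (t - 1) + a by omega]
  exact h'.symm

/-- for every `t ≥ 2` and every `k ≥ 4t - 3`, there is an
isolation set of size `k` in `A_{k,t}`. -/
theorem isolation_set_of_size_k (t k : ℕ) (ht : 2 ≤ t) (hk : 4 * t - 3 ≤ k) :
    ∃ x y : Fin k → Finset ℕ, IsIsolationSet k t k x y := by
  have hk₀ : 0 < k := by omega
  have htk : t ≤ k := by omega
  refine ⟨fun i => cyclicInterval k t (i + (t - 1)), fun i => cyclicInterval k t i,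
    fun i => ⟨cyclicInterval_subset hk₀ _ _, card_cyclicInterval htk _⟩,
    fun i => ⟨cyclicInterval_subset hk₀ _ _, card_cyclicInterval htk _⟩, fun i => ?_,
    fun i j hij => ?_⟩
  · refine ⟨(i + (t - 1)) % k + 1, Finset.mem_inter.2 ⟨Finset.mem_image.2 ⟨0, ?_, rfl⟩,
      Finset.mem_image.2 ⟨t - 1, ?_, rfl⟩⟩⟩ <;> rw [Finset.mem_range] <;> omega
  · by_contra! h
    obtain ⟨s, hs, hsj⟩ := exists_add_modEq_of_cyclicInterval_inter_ne_empty h.1.ne_empty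
    obtain ⟨r, hr, hri⟩ := exists_add_modEq_of_cyclicInterval_inter_ne_empty h.2.ne_empty
    have hsum : (i : ℕ) + (s + r) ≡ i + 0 [MOD k] := by
      rw [← add_assoc]
      exact (hsj.add_right r).trans hri
    have hzero : s + r = 0 :=
      (Nat.ModEq.add_left_cancel' _ hsum).eq_of_lt_of_lt (by omega) hk₀
    obtain rfl : s = 0 := by omega
    exact hij (Fin.ext (Nat.ModEq.eq_of_lt_of_lt hsj i.isLt j.isLt))
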